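/- Let k₀ be a finite field of characteristic p, let A be an integral domain that is a finitely generated k₀-algebra, let s be the transcendence degree of the fraction field of A over k₀, and let g ∈ A be transcendental over k₀. Then there exists a real constant c > 0 such that for every finite field F equipped with a k₀-algebra structure (i.e., every finite field extension F of k₀), the number of k₀-algebra homomorphisms φ : A → F for which the subfield of F generated by φ(g) over the prime field F_p is a proper subfield of F is finite and at most c·|F|^{s−1/2}. -/

import Mathlib

open MvPolynomial in
/-- If `A` is generated by `G` over `k` and every `a ∈ G` is a root of a polynomial `P a` with
coefficients in `k[x]`, then at most `∏ a ∈ G, natDegree (P a)` algebra homomorphisms `A → F`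
have a prescribed restriction to `x` for which no `P a` specializes to zero. -/
theorem ncard_algHom_le_prod_natDegree_mul {k A F ι : Type*} [CommRing k] [CommRing A]
    [Algebra k A] [Field F] [Finite F] [Algebra k F] (x : ι → A) (G : Finset A)
    (hG : Algebra.adjoin k (G : Set A) = ⊤) (P : A → Polynomial (MvPolynomial ι k))
    (hP : ∀ a ∈ G, (P a).eval₂ (aeval x).toRingHom a = 0) (T : Finset (ι → F)) :
    {φ : A →ₐ[k] F | (φ ∘ x) ∈ T ∧
      ∀ a ∈ G, (P a).map (aeval (φ ∘ x)).toRingHom ≠ 0}.ncard ≤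
      (∏ a ∈ G, (P a).natDegree) * T.card := by
  classical
  have hinj : Function.Injective (fun (φ : A →ₐ[k] F) (a : G) => φ a) := fun φ ψ h =>
    AlgHom.ext_of_adjoin_eq_top hG fun a ha => congrFun h ⟨a, ha⟩
  have : Finite (A →ₐ[k] F) := Finite.of_injective _ hinj
  have := Fintype.ofFinite (A →ₐ[k] F)
  rw [Set.ncard_eq_toFinset_card']
  refine Finset.card_le_mul_card_image_of_maps_to (f := fun (φ : A →ₐ[k] F) => (φ ∘ x : ι → F)) (fun φ hφ => ?_) _
    fun τ _ => ?_
  · exact (Set.mem_toFinset.1 hφ).1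
  · let R : G → Finset F := fun a => ((P a).map (aeval τ).toRingHom).roots.toFinset
    refine (Finset.card_le_card_of_injOn (t := Fintype.piFinset R) _ ?_ hinj.injOn).trans ?_
    · intro φ hφ
      simp only [Finset.coe_filter, Set.mem_toFinset, Set.mem_ofPred_eq] at hφ
      obtain ⟨⟨-, h⟩, rfl⟩ := hφ
      simp only [Finset.mem_coe, Fintype.mem_piFinset]
      intro a
      simp only [R, Multiset.mem_toFinset]
      rw [Polynomial.mem_roots (h a a.2), Polynomial.IsRoot, Polynomial.eval_map]
      have hcomp : (aeval (φ ∘ x)).toRingHom = (φ : A →+* F).comp (aeval (R := k) x).toRingHom := by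
        ext i <;> simp
      have := congrArg φ (hP a a.2)
      rw [map_zero] at this
      rw [hcomp, ← this]
      exact (Polynomial.hom_eval₂ (P a) (aeval (R := k) x).toRingHom (φ : A →+* F) a).symm
    · rw [Fintype.card_piFinset, ← Finset.prod_coe_sort G fun a => (P a).natDegree]
      exact Finset.prod_le_prod' fun a _ => (Multiset.toFinset_card_le _).trans
        ((Polynomial.card_roots' _).trans Polynomial.natDegree_map_le)

theorem finite_algHom_of_finiteType {k A F : Type*} [CommRing k] [CommRing A] [Algebra k A]
    [Algebra.FiniteType k A] [CommRing F] [Finite F] [Algebra k F] : Finite (A →ₐ[k] F) := by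
  obtain ⟨G, hG⟩ := Algebra.FiniteType.out (R := k) (A := A)
  exact Finite.of_injective (fun (φ : A →ₐ[k] F) (a : G) => φ a) fun φ ψ h =>
    AlgHom.ext_of_adjoin_eq_top hG fun a ha => congrFun h ⟨a, ha⟩

open MvPolynomial in
/-- The dimension drops in a proper quotient of a domain: lifts of algebraically independent
elements of `A ⧸ (h)` together with `h` are algebraically independent. -/
theorem AlgebraicIndependent.option_of_quotient_span_singleton {k A ι : Type*} [CommRing k]
    [CommRing A] [IsDomain A] [Algebra k A] {h : A} (h0 : h ≠ 0) {x : ι → A}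
    (hx : AlgebraicIndependent k (fun i => Ideal.Quotient.mkₐ k (Ideal.span {h}) (x i))) :
    AlgebraicIndependent k (fun o : Option ι => o.elim h x) := by
  have hx' : AlgebraicIndependent k x :=
    AlgebraicIndependent.of_comp (Ideal.Quotient.mkₐ k (Ideal.span {h})) hx
  rw [hx'.option_iff_transcendental]
  intro halg
  obtain ⟨c, d, hd, hcd⟩ := halg.exists_smul_eq_mul 1 (mem_nonZeroDivisors_of_ne_zero h0)
  obtain ⟨f, rfl⟩ := hx'.aevalEquiv.surjective d
  have hf : aeval x f = h * c := by
    rw [← hcd, Algebra.smul_def, mul_one, hx'.algebraMap_aevalEquiv]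
  have : aeval (fun i => Ideal.Quotient.mkₐ k (Ideal.span {h}) (x i)) f = 0 := by
    have h1 := comp_aeval_apply (f := x) (Ideal.Quotient.mkₐ k (Ideal.span {h})) f
    rw [← h1, hf]
    exact Ideal.Quotient.eq_zero_iff_mem.2 (Ideal.mul_mem_right _ _ (Ideal.mem_span_singleton_self h))
  apply hd
  rw [(algebraicIndependent_iff.1 hx) f this, map_zero]

open MvPolynomial in
/-- A proper closed subset of an affine variety of dimension `s` has `O(|F| ^ (s - 1))`
points over a finite field `F`. -/
theorem exists_ncard_algHom_apply_eq_zero_le {k A : Type*} [Field k] [CommRing A] [IsDomain A]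
    [Algebra k A] [Algebra.FiniteType k A] {s : ℕ}
    (hs : ∀ (d : ℕ) (x : Fin d → A), AlgebraicIndependent k x → d ≤ s + 1) {h : A} (h0 : h ≠ 0) :
    ∃ C : ℕ, ∀ (F : Type) [Field F] [Fintype F] [Algebra k F],
      {φ : A →ₐ[k] F | φ h = 0}.ncard ≤ C * Fintype.card F ^ s := by
  classical
  let I := Ideal.span {h}
  by_cases hI : I = ⊤
  · refine ⟨0, fun F _ _ _ => ?_⟩
    have : Finite (A →ₐ[k] F) := finite_algHom_of_finiteType
    rw [Nat.zero_mul, Nat.le_zero, Set.ncard_eq_zero]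
    refine Set.eq_empty_of_forall_notMem fun φ (hφ : φ h = 0) => ?_
    have hu : IsUnit h := Ideal.span_singleton_eq_top.1 hI
    exact (hu.map φ).ne_zero hφ
  have : Nontrivial (A ⧸ I) := Ideal.Quotient.nontrivial_iff.2 hI
  obtain ⟨d, f, hf, hint⟩ := exists_integral_inj_algHom_of_fg k (A ⧸ I)
  have hds : d ≤ s := by
    choose x hx using fun i => Ideal.Quotient.mkₐ_surjective k I (f (X i))
    have hind : AlgebraicIndependent k (fun i => Ideal.Quotient.mkₐ k I (x i)) := by
      have : aeval (fun i => Ideal.Quotient.mkₐ k I (x i)) = f := by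
        ext i; simp [hx]
      rw [algebraicIndependent_iff_injective_aeval, this]
      exact hf
    have := AlgebraicIndependent.option_of_quotient_span_singleton h0 hind
    have := hs (d + 1) _ (this.comp _ (finSuccEquiv d).injective)
    omega
  obtain ⟨G, hG⟩ := Algebra.FiniteType.out (R := k) (A := A ⧸ I)
  choose P hP hroot using hint
  have hfX : (aeval fun i => f (X i)) = f := by ext i; simp
  refine ⟨∏ a ∈ G, (P a).natDegree, fun F _ _ _ => ?_⟩
  have hfin : Finite ((A ⧸ I) →ₐ[k] F) := finite_algHom_of_finiteType
  have key := ncard_algHom_le_prod_natDegree_mul (F := F) (fun i => f (X i)) G hG P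
    (fun a _ => by rw [hfX]; exact hroot a) Finset.univ
  rw [Finset.card_univ, Fintype.card_fun, Fintype.card_fin] at key
  refine le_trans (le_trans ?_ key) (Nat.mul_le_mul_left _
    (Nat.pow_le_pow_right Fintype.card_pos hds))
  have hmap : {φ : A →ₐ[k] F | φ h = 0} ⊆
      (fun ψ : (A ⧸ I) →ₐ[k] F => ψ.comp (Ideal.Quotient.mkₐ k I)) '' Set.univ := by
    intro φ (hφ : φ h = 0)
    have hker : ∀ a ∈ I, φ a = 0 := fun a ha => by
      obtain ⟨b, rfl⟩ := Ideal.mem_span_singleton'.1 ha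
      rw [map_mul, hφ, mul_zero]
    exact ⟨Ideal.Quotient.liftₐ I φ hker, trivial, Ideal.Quotient.liftₐ_comp I φ hker⟩
  refine (Set.ncard_le_ncard hmap (Set.toFinite _)).trans ((Set.ncard_image_le).trans
    (Set.ncard_le_ncard (fun ψ _ => ⟨Finset.mem_univ _, fun a _ => ((hP a).map _).ne_zero⟩)
      (Set.toFinite _)))

/-- An element of a finite field `F` of characteristic `p` generating a proper subfield is a
root of some `X ^ p ^ d - X` with `0 < d` and `p ^ d ≤ √|F|`. -/
theorem Subfield.exists_pow_pow_eq_of_closure_ne_top {F : Type*} [Field F] [Fintype F] (p : ℕ)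
    [CharP F p] {y : F} (hy : Subfield.closure {y} ≠ ⊤) :
    ∃ d, 1 ≤ d ∧ p ^ d ≤ Nat.sqrt (Fintype.card F) ∧ y ^ p ^ d = y := by
  classical
  set E := Subfield.closure {y} with hE
  have : Fintype E := Fintype.ofFinite E
  obtain ⟨d, hp, hd⟩ := FiniteField.card E p
  refine ⟨d, d.2, ?_, ?_⟩
  · rw [← hd, Nat.le_sqrt, ← sq, Module.card_eq_pow_finrank (K := E) (V := F)]
    refine Nat.pow_le_pow_right Fintype.card_pos ?_
    have hpos : 0 < Module.finrank E F := Module.finrank_pos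
    by_contra! hlt
    have h1 : Module.finrank E F = 1 := by omega
    have hc := Module.card_eq_pow_finrank (K := E) (V := F)
    rw [h1, pow_one] at hc
    apply hy
    have hbij : Function.Bijective (Subtype.val : E → F) :=
      (Fintype.bijective_iff_injective_and_card _).2 ⟨Subtype.val_injective, hc.symm⟩
    refine eq_top_iff.2 fun z _ => ?_
    obtain ⟨w, rfl⟩ := hbij.2 z
    exact w.2
  · have hmem : y ∈ E := Subfield.subset_closure rfl
    have := FiniteField.pow_card (⟨y, hmem⟩ : E)
    rw [hd] at this
    simpa using congrArg Subtype.val this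

open Polynomial in
theorem Subfield.ncard_closure_singleton_ne_top_le {F : Type*} [Field F] [Fintype F] (p : ℕ)
    [CharP F p] :
    {y : F | Subfield.closure {y} ≠ ⊤}.ncard ≤ p * Nat.sqrt (Fintype.card F) := by
  classical
  have hp : p.Prime := CharP.char_is_prime F p
  have hq : Nat.sqrt (Fintype.card F) ≠ 0 := (Nat.sqrt_pos.2 Fintype.card_pos).ne'
  set m := Nat.log p (Nat.sqrt (Fintype.card F)) with hm
  let S : Finset F := (Finset.Icc 1 m).biUnion fun d => (X ^ p ^ d - X : F[X]).roots.toFinset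
  have hsub : {y : F | Subfield.closure {y} ≠ ⊤} ⊆ S := by
    intro y hy
    obtain ⟨d, hd, hle, hyd⟩ := Subfield.exists_pow_pow_eq_of_closure_ne_top p hy
    simp only [S, Finset.coe_biUnion, Set.mem_iUnion, Finset.mem_coe]
    refine ⟨d, Finset.mem_Icc.2 ⟨hd, Nat.le_log_of_pow_le hp.one_lt hle⟩, ?_⟩
    rw [Multiset.mem_toFinset, mem_roots
      (FiniteField.X_pow_card_pow_sub_X_ne_zero F (by omega) hp.one_lt)]
    simp [hyd]
  calc _ ≤ (S : Set F).ncard := Set.ncard_le_ncard hsub (Set.toFinite _)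
    _ = S.card := Set.ncard_coe_finset S
    _ ≤ ∑ d ∈ Finset.Icc 1 m, (X ^ p ^ d - X : F[X]).roots.toFinset.card :=
      Finset.card_biUnion_le
    _ ≤ ∑ d ∈ Finset.Icc 1 m, p ^ d := by
      refine Finset.sum_le_sum fun d hd => (Multiset.toFinset_card_le _).trans
        ((card_roots' _).trans_eq ?_)
      exact FiniteField.X_pow_card_pow_sub_X_natDegree_eq F
        (by have := Finset.mem_Icc.1 hd; omega) hp.one_lt
    _ ≤ p ^ (m + 1) := (Nat.geomSum_lt hp.two_le fun d hd => by
        have := Finset.mem_Icc.1 hd; omega).le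
    _ = p * p ^ m := pow_succ' p m
    _ ≤ _ := Nat.mul_le_mul_left _ (Nat.pow_log_le_self p hq)

open MvPolynomial in
theorem IsTranscendenceBasis.exists_polynomial_eval₂_eq_zero {k A ι : Type*} [CommRing k]
    [Nontrivial k] [CommRing A] [Algebra k A] {x : ι → A} (hx : IsTranscendenceBasis k x) (a : A) :
    ∃ P : Polynomial (MvPolynomial ι k), P ≠ 0 ∧ P.eval₂ (aeval x).toRingHom a = 0 := by
  obtain ⟨Q, hQ, hQa⟩ := hx.isAlgebraic.isAlgebraic a
  let e := hx.1.aevalEquiv.symm.toRingEquiv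
  refine ⟨Q.map e.toRingHom, (Polynomial.map_ne_zero_iff e.injective).2 hQ, ?_⟩
  rw [Polynomial.eval₂_map]
  convert hQa using 1
  rw [Polynomial.aeval_def]
  congr 1
  ext r
  obtain ⟨f, rfl⟩ := hx.1.aevalEquiv.surjective r
  simp [e]

/-- The number of functions `ι → F` whose value at `i` lies in `Y`. -/
theorem card_filter_apply_mem {ι F : Type*} [Fintype ι] [DecidableEq ι] [Fintype F]
    [DecidableEq F] (i : ι) (Y : Finset F) :
    (Finset.univ.filter fun τ : ι → F => τ i ∈ Y).card =
      Y.card * Fintype.card F ^ (Fintype.card ι - 1) := by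
  have : (Finset.univ.filter fun τ : ι → F => τ i ∈ Y) =
      Fintype.piFinset (Function.update (fun _ => Finset.univ) i Y) := by
    ext τ
    simp only [Finset.mem_filter, Finset.mem_univ, true_and, Fintype.mem_piFinset]
    refine ⟨fun h j => ?_, fun h => by simpa using h i⟩
    by_cases hj : j = i
    · subst hj; simpa using h
    · simp [Function.update_of_ne hj]
  rw [this, Fintype.card_piFinset, ← Finset.mul_prod_erase _ _ (Finset.mem_univ i)]
  rw [Finset.prod_congr rfl (g := fun _ => Fintype.card F)]
  · simp [Finset.card_erase_of_mem]
  · intro j hj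
    simp [Function.update_of_ne (Finset.ne_of_mem_erase hj)]


/-- Let `k₀` be a finite field of characteristic `p`, `A` an integral domain that is a
finitely generated `k₀`-algebra, `s` the transcendence degree of `Frac(A)` over `k₀`,
and `g ∈ A` transcendental over `k₀`. Then there is `c > 0` such that for every finite
field extension `F` of `k₀`, the set of `k₀`-algebra homomorphisms `φ : A → F` for
which `φ(g)` generates (over the prime field `F_p`) a proper subfield of `F` is finite
of size at most `c · |F|^s / √|F|`. -/
theorem stmt_13 {k₀ : Type*} [Field k₀] [Fintype k₀] {p : ℕ} [CharP k₀ p]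
    {A : Type*} [CommRing A] [IsDomain A] [Algebra k₀ A] [Algebra.FiniteType k₀ A]
    {K : Type*} [Field K] [Algebra A K] [IsFractionRing A K]
    [Algebra k₀ K] [IsScalarTower k₀ A K]
    {s : ℕ} (hs : ∃ b : Fin s → K, IsTranscendenceBasis k₀ b)
    (g : A) (hg : Transcendental k₀ g) :
    ∃ c : ℝ, 0 < c ∧
      ∀ (F : Type) [Field F] [Fintype F] [Algebra k₀ F],
        {φ : A →ₐ[k₀] F | Subfield.closure {φ g} ≠ ⊤}.Finite ∧
        ({φ : A →ₐ[k₀] F | Subfield.closure {φ g} ≠ ⊤}.ncard : ℝ) ≤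
          c * (Fintype.card F : ℝ) ^ s / Real.sqrt (Fintype.card F) := by
  classical
  obtain ⟨b, hb⟩ := hs
  have hAK : Function.Injective (algebraMap A K) := IsFractionRing.injective A K
  have : FaithfulSMul A K := (faithfulSMul_iff_algebraMap_injective A K).2 hAK
  have hAlg : Algebra.IsAlgebraic A K :=
    (IsFractionRing.comap_isAlgebraic_iff (K := K)).2 inferInstance
  have hbound : ∀ (d : ℕ) (x : Fin d → A), AlgebraicIndependent k₀ x → d ≤ s := by
    intro d x hx
    have h1 := (hx.map' (f := IsScalarTower.toAlgHom k₀ A K) hAK).lift_cardinalMk_le_trdeg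
    rw [← hb.lift_cardinalMk_eq_trdeg] at h1
    simpa using h1
  have hgs : AlgebraicIndepOn k₀ id ({g} : Set A) := by
    rw [AlgebraicIndepOn, algebraicIndependent_unique_type_iff]
    exact hg
  obtain ⟨t, hgt, ht⟩ := exists_isTranscendenceBasis_superset hgs
  let i₀ : t := ⟨g, hgt rfl⟩
  have hcard := (ht.algebraMap_comp (A := K)).lift_cardinalMk_eq hb
  have : Fintype t := by
    have : Finite t := by
      rw [← Cardinal.mk_lt_aleph0_iff, ← Cardinal.lift_lt_aleph0, hcard]
      simp
    exact Fintype.ofFinite t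
  have hts : Fintype.card t = s := by simpa using hcard
  obtain ⟨n, rfl⟩ : ∃ n, s = n + 1 :=
    ⟨s - 1, by have := Fintype.card_pos_iff.2 ⟨i₀⟩; omega⟩
  obtain ⟨G, hG⟩ := Algebra.FiniteType.out (R := k₀) (A := A)
  choose P hP0 hP using ht.exists_polynomial_eval₂_eq_zero
  let f : MvPolynomial t k₀ := ∏ a ∈ G, (P a).leadingCoeff
  have hf : f ≠ 0 := Finset.prod_ne_zero_iff.2 fun a _ => Polynomial.leadingCoeff_ne_zero.2 (hP0 a)
  have h0 : MvPolynomial.aeval ((↑) : t → A) f ≠ 0 := fun h =>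
    hf (algebraicIndependent_iff.1 ht.1 f h)
  obtain ⟨C, hC⟩ := exists_ncard_algHom_apply_eq_zero_le hbound h0
  refine ⟨C + (∏ a ∈ G, (P a).natDegree) * p + 1, by positivity, fun F _ _ _ => ?_⟩
  have hfin : Finite (A →ₐ[k₀] F) := finite_algHom_of_finiteType
  refine ⟨Set.toFinite _, ?_⟩
  have : CharP F p := charP_of_injective_algebraMap (algebraMap k₀ F).injective p
  let Y : Finset F := {y : F | Subfield.closure {y} ≠ ⊤}.toFinset
  have hY : Y.card ≤ p * Nat.sqrt (Fintype.card F) := by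
    rw [← Set.ncard_eq_toFinset_card']
    exact Subfield.ncard_closure_singleton_ne_top_le p
  have hgood := ncard_algHom_le_prod_natDegree_mul (F := F) ((↑) : t → A) G hG P
    (fun a _ => hP a) (Finset.univ.filter fun τ => τ i₀ ∈ Y)
  rw [card_filter_apply_mem, hts, Nat.add_sub_cancel] at hgood
  have hsub : {φ : A →ₐ[k₀] F | Subfield.closure {φ g} ≠ ⊤} ⊆
      {φ | φ (MvPolynomial.aeval ((↑) : t → A) f) = 0} ∪
      {φ | (φ ∘ ((↑) : t → A)) ∈ (Finset.univ.filter fun τ : t → F => τ i₀ ∈ Y) ∧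
        ∀ a ∈ G, (P a).map (MvPolynomial.aeval (φ ∘ ((↑) : t → A))).toRingHom ≠ 0} := by
    intro φ hφ
    by_cases hz : φ (MvPolynomial.aeval ((↑) : t → A) f) = 0
    · exact Or.inl hz
    · refine Or.inr ⟨?_, fun a ha hzero => hz ?_⟩
      · simpa [Y, i₀] using hφ
      · have hlc : MvPolynomial.aeval (φ ∘ ((↑) : t → A)) (P a).leadingCoeff = 0 := by
          have := congrArg (Polynomial.coeff · (P a).natDegree) hzero
          simpa [Polynomial.coeff_map] using this
        rw [MvPolynomial.comp_aeval_apply]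
        change MvPolynomial.aeval (φ ∘ ((↑) : t → A)) f = 0
        rw [map_prod]
        exact Finset.prod_eq_zero ha hlc
  have hnat : {φ : A →ₐ[k₀] F | Subfield.closure {φ g} ≠ ⊤}.ncard ≤
      C * Fintype.card F ^ n + (∏ a ∈ G, (P a).natDegree) *
        (p * Nat.sqrt (Fintype.card F) * Fintype.card F ^ n) :=
    (Set.ncard_le_ncard hsub (Set.toFinite _)).trans ((Set.ncard_union_le _ _).trans
      (Nat.add_le_add (hC F) (hgood.trans (by gcongr))))
  set q := Fintype.card F with hq
  have hq1 : (1 : ℝ) ≤ q := by exact_mod_cast (Fintype.card_pos : 0 < Fintype.card F)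
  have hr1 : 1 ≤ Real.sqrt q := Real.one_le_sqrt.2 hq1
  have hr : (Nat.sqrt q : ℝ) ≤ Real.sqrt q := Real.nat_sqrt_le_real_sqrt
  have hdiv : ∀ c : ℝ, c * (q : ℝ) ^ (n + 1) / Real.sqrt q = c * (q : ℝ) ^ n * Real.sqrt q := by
    intro c
    rw [div_eq_iff (by positivity), mul_assoc _ (Real.sqrt q), Real.mul_self_sqrt (by positivity)]
    ring
  rw [hdiv]
  calc _ ≤ (C : ℝ) * (q : ℝ) ^ n + (∏ a ∈ G, (P a).natDegree : ℕ) *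
        (p * Nat.sqrt q * (q : ℝ) ^ n) := by exact_mod_cast hnat
    _ ≤ (C : ℝ) * (q : ℝ) ^ n * Real.sqrt q + (∏ a ∈ G, (P a).natDegree : ℕ) *
        (p * Real.sqrt q * (q : ℝ) ^ n) + (q : ℝ) ^ n * Real.sqrt q := by
      have h1 : (C : ℝ) * (q : ℝ) ^ n ≤ (C : ℝ) * (q : ℝ) ^ n * Real.sqrt q :=
        le_mul_of_one_le_right (by positivity) hr1
      have h2 : 0 ≤ (q : ℝ) ^ n * Real.sqrt q := by positivity
      have h3 : ((∏ a ∈ G, (P a).natDegree : ℕ) : ℝ) * (p * Nat.sqrt q * (q : ℝ) ^ n) ≤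
        (∏ a ∈ G, (P a).natDegree : ℕ) * (p * Real.sqrt q * (q : ℝ) ^ n) := by gcongr
      linarith
    _ = _ := by push_cast; ring
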